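/- For every natural number s, every integer n with |n| \le s, and every p \in S^2, \int_{S^2} \sqrt{1-(p\cdot q)^2}\, Y_s^n(q)\, dq = \mu_O(s)\, Y_s^n(p), where \mu_O(s) = -\pi\,\Gamma(s/2+1/2)\,\Gamma(s/2-1/2)/(2\,\Gamma(s/2+1)\,\Gamma(s/2+2)) if s is even, and \mu_O(s) = 0 if s is odd. In particular every spherical harmonic is an eigenfunction of the integral operator with the Onsager kernel. -/

import Mathlib

open MeasureTheory

noncomputable section

/-- The unit sphere `S²` in `ℝ³`. -/
abbrev S2 := Metric.sphere (0 : EuclideanSpace ℝ (Fin 3)) 1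

/-- The surface measure on `S²` (of total mass `4π`). -/
def sphereMeasure : Measure S2 := (volume : Measure (EuclideanSpace ℝ (Fin 3))).toSphere

/-- The associated Legendre function
`P_l^m(μ) = (1/(2^l l!)) (1−μ²)^(m/2) (d^(l+m)/dμ^(l+m))(μ²−1)^l`. -/
def assocLegendre (l : ℕ) (m : ℤ) (x : ℝ) : ℝ :=
  (1 / (2 ^ l * (l.factorial : ℝ))) * (1 - x ^ 2) ^ ((m : ℝ) / 2) *
    iteratedDeriv ((l : ℤ) + m).toNat (fun y : ℝ => (y ^ 2 - 1) ^ l) x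

/-- The normalisation constant `N_{lm} = (−1)^m ((2l+1)/(4π))^(1/2) ((l−m)!/(l+m)!)^(1/2)`. -/
def sphNormal (l : ℕ) (m : ℤ) : ℝ :=
  (-1 : ℝ) ^ m * Real.sqrt ((2 * l + 1) / (4 * Real.pi)) *
    Real.sqrt (((((l : ℤ) - m).toNat.factorial : ℝ)) / ((((l : ℤ) + m).toNat.factorial : ℝ)))

/-- The azimuthal angle `φ` of a point of `S²`. -/
def azimuth (p : S2) : ℝ :=
  Complex.arg ⟨(p : EuclideanSpace ℝ (Fin 3)) 0, (p : EuclideanSpace ℝ (Fin 3)) 1⟩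

/-- The spherical harmonic `Y_l^m : S² → ℂ`, `Y_l^m(φ,θ) = N_{lm} e^{imφ} P_l^m(cos θ)`,
where `cos θ` is the third coordinate of the point. -/
def sphHarm (l : ℕ) (m : ℤ) (p : S2) : ℂ :=
  (sphNormal l m : ℂ) * Complex.exp (Complex.I * m * azimuth p) *
    (assocLegendre l m ((p : EuclideanSpace ℝ (Fin 3)) 2) : ℂ)

/-- The eigenvalue of the Onsager interaction operator on spherical harmonics of degree `s`:
`μ_O(s) = -π Γ(s/2+1/2)Γ(s/2-1/2)/(2Γ(s/2+1)Γ(s/2+2))` for even `s` and `0` for odd `s`. -/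
def onsagerEigenvalue (s : ℕ) : ℝ :=
  if Even s then
    -(Real.pi * Real.Gamma ((s : ℝ) / 2 + 1 / 2) * Real.Gamma ((s : ℝ) / 2 - 1 / 2)) /
      (2 * Real.Gamma ((s : ℝ) / 2 + 1) * Real.Gamma ((s : ℝ) / 2 + 2))
  else 0

theorem Ring.choose_succ_mul (a : ℝ) (n : ℕ) :
    Ring.choose a (n + 1) * (n + 1) = Ring.choose a n * (a - n) := by
  have h := Ring.choose_smul_choose a (Nat.le_succ n)
  simpa [mul_comm] using h

theorem Ring.choose_neg_three_halves (j : ℕ) :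
    Ring.choose (-(3 / 2) : ℝ) j * (j.factorial * Real.Gamma (3 / 2)) =
      (-1) ^ j * Real.Gamma (j + 3 / 2) := by
  induction j with
  | zero => simp
  | succ j ih =>
    have h := Ring.choose_succ_mul (-(3 / 2)) j
    have hG : Real.Gamma ((j + 1 : ℕ) + 3 / 2) = (j + 3 / 2) * Real.Gamma (j + 3 / 2) := by
      rw [← Real.Gamma_add_one (by positivity)]; push_cast; ring_nf
    rw [hG, Nat.factorial_succ, pow_succ]
    push_cast
    linear_combination (j.factorial * Real.Gamma (3 / 2)) * h - (3 / 2 + j : ℝ) * ih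

theorem Ring.choose_sub_three_halves (r : ℕ) :
    Ring.choose ((r : ℝ) - 3 / 2) r * (r.factorial * Real.Gamma (-1 / 2)) =
      Real.Gamma (r - 1 / 2) := by
  induction r with
  | zero => simp; norm_num
  | succ r ih =>
    have h := Ring.choose_add_smul_choose ((r : ℝ) - 3 / 2) r 1
    have hr : (r : ℝ) - 1 / 2 ≠ 0 := by
      intro h
      have : (2 * r : ℤ) = 1 := by exact_mod_cast (by linarith : (2 * r : ℝ) = 1)
      omega
    have hG : Real.Gamma ((r + 1 : ℕ) - 1 / 2) = (r - 1 / 2) * Real.Gamma (r - 1 / 2) := by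
      rw [← Real.Gamma_add_one hr]; push_cast; ring_nf
    rw [hG, ← ih, Nat.factorial_succ]
    simp only [Nat.choose_one_right, nsmul_eq_mul, Ring.choose_one_right] at h
    push_cast at h ⊢
    rw [show (r : ℝ) + 1 - 3 / 2 = r - 3 / 2 + 1 by ring]
    linear_combination (r.factorial * Real.Gamma (-1 / 2)) * h

theorem Real.Gamma_natCast_add_half_mul (m : ℕ) :
    Real.Gamma (m + 1 / 2) * (4 ^ m * m.factorial) = (2 * m).factorial * √Real.pi := by
  induction m with
  | zero => simp [← Real.Gamma_one_half_eq]
  | succ m ih =>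
    have hG : Real.Gamma ((m + 1 : ℕ) + 1 / 2) = (m + 1 / 2) * Real.Gamma (m + 1 / 2) := by
      rw [← Real.Gamma_add_one (by positivity)]; push_cast; ring_nf
    rw [hG, show 2 * (m + 1) = 2 * m + 1 + 1 by ring, Nat.factorial_succ, Nat.factorial_succ,
      Nat.factorial_succ]
    push_cast
    linear_combination (2 * m + 1) * (2 * m + 2) * ih

/-- An instance of the Chu–Vandermonde identity. -/
theorem sum_choose_mul_Gamma (r : ℕ) :
    ∑ j ∈ Finset.range (r + 1),
      (r.choose j : ℝ) * ((-1) ^ j * Real.Gamma (j + 3 / 2) / j.factorial) =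
      -(Real.Gamma (r - 1 / 2) / (4 * r.factorial)) := by
  have hv := Ring.add_choose_eq (r := -(3 / 2 : ℝ)) (s := r) r (Commute.all _ _)
  rw [Finset.Nat.sum_antidiagonal_eq_sum_range_succ_mk, neg_add_eq_sub] at hv
  have h3 : Real.Gamma (3 / 2) = √Real.pi / 2 := by
    rw [show (3 / 2 : ℝ) = 1 / 2 + 1 by norm_num, Real.Gamma_add_one (by norm_num),
      Real.Gamma_one_half_eq]; ring
  have h1 : Real.Gamma (-1 / 2) = -2 * √Real.pi := by
    have := Real.Gamma_add_one (s := -1 / 2) (by norm_num)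
    rw [show (-1 / 2 + 1 : ℝ) = 1 / 2 by norm_num, Real.Gamma_one_half_eq] at this
    linarith
  have hs := Ring.choose_sub_three_halves r
  have hfac : (r.factorial : ℝ) ≠ 0 := by positivity
  have hpi : √Real.pi ≠ 0 := by positivity
  have e : -(Real.Gamma (r - 1 / 2) / (4 * r.factorial)) =
      Real.Gamma (3 / 2) * Ring.choose ((r : ℝ) - 3 / 2) r := by
    rw [← hs, h1, h3]; field_simp; ring
  rw [e, hv, Finset.mul_sum]
  refine Finset.sum_congr rfl fun j hj => ?_
  have hj' : (j.factorial : ℝ) ≠ 0 := by positivity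
  rw [← Ring.choose_neg_three_halves, Ring.choose_natCast,
    Nat.choose_symm (Finset.mem_range_succ_iff.mp hj)]
  field_simp

theorem sum_gaussianMoments (r : ℕ) :
    ∑ j ∈ Finset.range (r + 1), ((2 * r).choose (2 * j) : ℝ) * ((2 * j).choose j) *
      (-1 / 4) ^ j * (Real.pi * Real.Gamma (j + 3 / 2)) * Real.Gamma ((r - j : ℕ) + 1 / 2) =
    1 / 2 * Real.Gamma ((2 * r : ℕ) / 2 + 2) * onsagerEigenvalue (2 * r) := by
  have e : 1 / 2 * Real.Gamma ((2 * r : ℕ) / 2 + 2) * onsagerEigenvalue (2 * r) =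
      Real.pi * Real.Gamma (r + 1 / 2) * -(Real.Gamma (r - 1 / 2) / (4 * r.factorial)) := by
    have h2 : ((2 * r : ℕ) : ℝ) / 2 = r := by push_cast; ring
    rw [onsagerEigenvalue, if_pos (even_two_mul r), h2, Real.Gamma_nat_eq_factorial]
    have : Real.Gamma ((r : ℝ) + 2) ≠ 0 := (Real.Gamma_pos_of_pos (by positivity)).ne'
    field_simp
    norm_num
    ring
  rw [e, ← sum_choose_mul_Gamma, Finset.mul_sum]
  refine Finset.sum_congr rfl fun j hj => ?_
  have hj := Finset.mem_range_succ_iff.mp hj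
  obtain ⟨m, rfl⟩ := Nat.exists_eq_add_of_le hj
  have g1 := Real.Gamma_natCast_add_half_mul m
  have g2 := Real.Gamma_natCast_add_half_mul (j + m)
  have c1 : ((2 * (j + m)).choose (2 * j) : ℝ) * (2 * j).factorial * (2 * m).factorial =
      (2 * (j + m)).factorial := by
    rw [show 2 * (j + m) = 2 * j + 2 * m by ring]
    rw [Nat.choose_symm_add]
    exact_mod_cast Nat.add_choose_mul_factorial_mul_factorial (2 * j) (2 * m)
  have c2 : ((2 * j).choose j : ℝ) * j.factorial * j.factorial = (2 * j).factorial := by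
    rw [two_mul]; exact_mod_cast Nat.add_choose_mul_factorial_mul_factorial j j
  have c3 : ((j + m).choose j : ℝ) * j.factorial * m.factorial = (j + m).factorial := by
    rw [Nat.choose_symm_add]
    exact_mod_cast Nat.add_choose_mul_factorial_mul_factorial j m
  have f1 : (j.factorial : ℝ) ≠ 0 := by positivity
  have f2 : (m.factorial : ℝ) ≠ 0 := by positivity
  have f3 : ((2 * m).factorial : ℝ) ≠ 0 := by positivity
  have f4 : ((2 * j).factorial : ℝ) ≠ 0 := by positivity
  have f5 : ((j + m).factorial : ℝ) ≠ 0 := by positivity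
  rw [Nat.add_sub_cancel_left]
  rw [← eq_div_iff (by positivity)] at g1 g2
  rw [mul_assoc, ← eq_div_iff (by positivity)] at c1 c2 c3
  rw [g1, g2, c1, c2, c3, show (-1 / 4 : ℝ) ^ j = (-1) ^ j / 4 ^ j by rw [div_pow]]
  field_simp
  ring

/-- Monomials `z ^ k * conj z ^ l` with `k ≠ l` have zero integral against radial weights. -/
theorem Complex.integral_pow_mul_conj_pow_mul_radial_eq_zero (w : ℝ → ℂ) {k l : ℕ} (hkl : k ≠ l) :
    ∫ z : ℂ, z ^ k * (starRingEnd ℂ z) ^ l * w ‖z‖ = 0 := by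
  set θ : ℝ := Real.pi / ((k : ℝ) - l) with hθ
  set c : Circle := Circle.exp θ with hc
  have hd : ((k : ℂ) - l) ≠ 0 := sub_ne_zero.mpr (by exact_mod_cast hkl)
  have hrot : (c : ℂ) ^ k * (starRingEnd ℂ (c : ℂ)) ^ l = -1 := by
    rw [hc, Circle.coe_exp, ← Complex.exp_conj, ← Complex.exp_nat_mul, ← Complex.exp_nat_mul,
      ← Complex.exp_add, ← Complex.exp_pi_mul_I]
    congr 1
    simp only [map_mul, Complex.conj_ofReal, Complex.conj_I, hθ]
    push_cast
    field_simp
    ring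
  have h := (rotation c).measurePreserving.integral_comp
    (rotation c).toHomeomorph.measurableEmbedding
    (fun z : ℂ => z ^ k * (starRingEnd ℂ z) ^ l * w ‖z‖)
  have e : ∀ z : ℂ, (rotation c z) ^ k * (starRingEnd ℂ (rotation c z)) ^ l * w ‖rotation c z‖ =
      -(z ^ k * (starRingEnd ℂ z) ^ l * w ‖z‖) := by
    intro z
    rw [LinearIsometryEquiv.norm_map, rotation_apply, map_mul, mul_pow, mul_pow]
    linear_combination (z ^ k * (starRingEnd ℂ z) ^ l * w ‖z‖) * hrot
  simp only [e, integral_neg] at h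
  exact CharZero.eq_neg_self_iff.mp h.symm

theorem Complex.integral_norm_pow_mul_exp_neg_sq (m : ℕ) :
    ∫ z : ℂ, ‖z‖ ^ m * Real.exp (-‖z‖ ^ 2) = Real.pi * Real.Gamma ((m + 2) / 2) := by
  have h := Complex.integral_rpow_mul_exp_neg_rpow (p := 2) (q := m) one_le_two
    (by linarith [m.cast_nonneg (α := ℝ)])
  simp only [Real.rpow_natCast, Real.rpow_two] at h
  rw [h]; ring

theorem Complex.integrable_norm_pow_mul_exp_neg_sq (m : ℕ) :
    Integrable fun z : ℂ => ‖z‖ ^ m * Real.exp (-‖z‖ ^ 2) := by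
  by_contra h
  have h' := Complex.integral_norm_pow_mul_exp_neg_sq m
  rw [integral_undef h] at h'
  have : 0 < Real.pi * Real.Gamma (((m : ℝ) + 2) / 2) :=
    mul_pos Real.pi_pos (Real.Gamma_pos_of_pos (by positivity))
  linarith

theorem Real.integral_Ioi_pow_mul_exp_neg_sq (m : ℕ) :
    ∫ t in Set.Ioi (0 : ℝ), t ^ m * Real.exp (-t ^ 2) = 1 / 2 * Real.Gamma ((m + 1) / 2) := by
  have h := integral_rpow_mul_exp_neg_rpow (p := 2) (q := m) two_pos
    (by linarith [m.cast_nonneg (α := ℝ)])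
  simpa only [Real.rpow_natCast, Real.rpow_two] using h

theorem Real.integral_abs_pow_mul_exp_neg_sq (m : ℕ) :
    ∫ t : ℝ, |t| ^ m * Real.exp (-t ^ 2) = Real.Gamma ((m + 1) / 2) := by
  have h := integral_comp_abs (f := fun t => t ^ m * Real.exp (-t ^ 2))
  simp only [sq_abs] at h
  rw [h, Real.integral_Ioi_pow_mul_exp_neg_sq]; ring

theorem Real.integrable_pow_mul_exp_neg_sq (m : ℕ) :
    Integrable fun t : ℝ => t ^ m * Real.exp (-t ^ 2) := by
  have h : Integrable fun t : ℝ => |t| ^ m * Real.exp (-t ^ 2) := by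
    by_contra h
    have h' := Real.integral_abs_pow_mul_exp_neg_sq m
    rw [integral_undef h] at h'
    have : 0 < Real.Gamma (((m : ℝ) + 1) / 2) := Real.Gamma_pos_of_pos (by positivity)
    linarith
  exact h.mono' (by fun_prop) (.of_forall fun t => by simp)

theorem Real.integral_even_pow_mul_exp_neg_sq (i : ℕ) :
    ∫ t : ℝ, t ^ (2 * i) * Real.exp (-t ^ 2) = Real.Gamma (i + 1 / 2) := by
  have h := Real.integral_abs_pow_mul_exp_neg_sq (2 * i)
  simp only [(even_two_mul i).pow_abs] at h
  rw [h]; push_cast; ring_nf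

theorem Real.integral_odd_pow_mul_exp_neg_sq {m : ℕ} (hm : Odd m) :
    ∫ t : ℝ, t ^ m * Real.exp (-t ^ 2) = 0 := by
  have h := integral_neg_eq_self (fun t : ℝ => t ^ m * Real.exp (-t ^ 2)) volume
  simp only [hm.neg_pow, even_two.neg_pow, neg_mul, integral_neg] at h
  exact CharZero.eq_neg_self_iff.mp h.symm

/-- The Onsager kernel on `ℂ × ℝ ≃ ℝ³` with polar axis `ℝ`, times a Gaussian
in the `ℂ` variable. -/
def axialWeight (z : ℂ) : ℂ := (‖z‖ * Real.exp (-‖z‖ ^ 2) : ℝ)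

theorem integrable_pow_mul_conj_pow_mul_axialWeight (k l : ℕ) :
    Integrable fun z : ℂ => z ^ k * (starRingEnd ℂ z) ^ l * axialWeight z := by
  refine (Complex.integrable_norm_pow_mul_exp_neg_sq (k + l + 1)).mono'
    (by unfold axialWeight; exact (by fun_prop : Continuous _).aestronglyMeasurable)
    (.of_forall fun z => le_of_eq ?_)
  simp only [axialWeight, norm_mul, norm_pow, RCLike.norm_conj, Complex.norm_real,
    Real.norm_eq_abs, Real.abs_exp, abs_norm]
  ring

theorem integral_pow_mul_conj_pow_mul_axialWeight (j : ℕ) :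
    ∫ z : ℂ, z ^ j * (starRingEnd ℂ z) ^ j * axialWeight z =
      (Real.pi * Real.Gamma (j + 3 / 2) : ℝ) := by
  have h := Complex.integral_norm_pow_mul_exp_neg_sq (2 * j + 1)
  rw [show (((2 * j + 1 : ℕ) : ℝ) + 2) / 2 = j + 3 / 2 by push_cast; ring] at h
  rw [← h, ← integral_complex_ofReal]
  congr 1 with z
  rw [← mul_pow, Complex.mul_conj, Complex.normSq_eq_norm_sq, axialWeight]
  push_cast
  ring

theorem integrable_linear_pow_mul_axialWeight (α β : ℂ) (k : ℕ) :
    Integrable fun z : ℂ => (α * z + β * starRingEnd ℂ z) ^ k * axialWeight z := by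
  simp only [add_pow, Finset.sum_mul]
  refine integrable_finsetSum _ fun i _ => ?_
  refine ((integrable_pow_mul_conj_pow_mul_axialWeight i (k - i)).const_mul
    (α ^ i * β ^ (k - i) * k.choose i)).congr (.of_forall fun z => ?_)
  simp only [mul_pow]; ring

theorem integral_linear_pow_mul_axialWeight (α β : ℂ) (k : ℕ) :
    ∫ z : ℂ, (α * z + β * starRingEnd ℂ z) ^ k * axialWeight z =
      ∑ i ∈ Finset.range (k + 1), α ^ i * β ^ (k - i) * k.choose i *
        ∫ z : ℂ, z ^ i * (starRingEnd ℂ z) ^ (k - i) * axialWeight z := by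
  simp only [← integral_const_mul]
  rw [← integral_finsetSum]
  · congr 1 with z
    simp only [add_pow, Finset.sum_mul, mul_pow]
    exact Finset.sum_congr rfl fun _ _ => by ring
  · exact fun i _ => (integrable_pow_mul_conj_pow_mul_axialWeight i (k - i)).const_mul _

theorem integral_linear_pow_even_mul_axialWeight (α β : ℂ) (j : ℕ) :
    ∫ z : ℂ, (α * z + β * starRingEnd ℂ z) ^ (2 * j) * axialWeight z =
      (α * β) ^ j * (2 * j).choose j * (Real.pi * Real.Gamma (j + 3 / 2) : ℝ) := by
  rw [integral_linear_pow_mul_axialWeight, Finset.sum_eq_single j]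
  · rw [show 2 * j - j = j by omega, integral_pow_mul_conj_pow_mul_axialWeight, mul_pow]
  · intro i _ hi
    unfold axialWeight
    rw [Complex.integral_pow_mul_conj_pow_mul_radial_eq_zero
      (fun r => (r * Real.exp (-r ^ 2) : ℝ)) (by omega), mul_zero]
  · intro h; simp at h; omega

theorem integral_linear_pow_odd_mul_axialWeight (α β : ℂ) {k : ℕ} (hk : Odd k) :
    ∫ z : ℂ, (α * z + β * starRingEnd ℂ z) ^ k * axialWeight z = 0 := by
  rw [integral_linear_pow_mul_axialWeight]
  refine Finset.sum_eq_zero fun i _ => ?_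
  obtain ⟨m, rfl⟩ := hk
  unfold axialWeight
  rw [Complex.integral_pow_mul_conj_pow_mul_radial_eq_zero
    (fun r => (r * Real.exp (-r ^ 2) : ℝ)) (by omega), mul_zero]

/-- The value of the Onsager operator at the pole, with the Gaussian radial factor included, for
the `s`-th power of an isotropic linear form. -/
theorem integral_isotropic_pow_mul_axialWeight {α β c : ℂ} (h : α * β = -c ^ 2 / 4) (s : ℕ) :
    ∫ x : ℂ × ℝ, (α * x.1 + β * starRingEnd ℂ x.1 + c * x.2) ^ s *
      (axialWeight x.1 * Real.exp (-x.2 ^ 2)) =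
      (1 / 2 * Real.Gamma (s / 2 + 2) * onsagerEigenvalue s : ℝ) * c ^ s := by
  have hint : ∀ m : ℕ, ∫ t : ℝ, (t : ℂ) ^ m * Real.exp (-t ^ 2) =
      ((∫ t : ℝ, t ^ m * Real.exp (-t ^ 2) : ℝ) : ℂ) := fun m => by
    rw [← integral_complex_ofReal]; push_cast; rfl
  have hsum : ∫ x : ℂ × ℝ, (α * x.1 + β * starRingEnd ℂ x.1 + c * x.2) ^ s *
      (axialWeight x.1 * Real.exp (-x.2 ^ 2)) =
      ∑ k ∈ Finset.range (s + 1), (s.choose k * c ^ (s - k)) *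
        ((∫ z : ℂ, (α * z + β * starRingEnd ℂ z) ^ k * axialWeight z) *
          ((∫ t : ℝ, t ^ (s - k) * Real.exp (-t ^ 2) : ℝ) : ℂ)) := by
    have hprod : ∀ k : ℕ, (∫ z : ℂ, (α * z + β * starRingEnd ℂ z) ^ k * axialWeight z) *
        ((∫ t : ℝ, t ^ (s - k) * Real.exp (-t ^ 2) : ℝ) : ℂ) =
        ∫ x : ℂ × ℝ, ((α * x.1 + β * starRingEnd ℂ x.1) ^ k * axialWeight x.1) *
          ((x.2 : ℂ) ^ (s - k) * Real.exp (-x.2 ^ 2)) := fun k => by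
      rw [← hint]
      exact (integral_prod_mul (fun z : ℂ => (α * z + β * starRingEnd ℂ z) ^ k * axialWeight z)
        (fun t : ℝ => (t : ℂ) ^ (s - k) * Real.exp (-t ^ 2))).symm
    simp only [hprod, ← integral_const_mul]
    rw [← integral_finsetSum]
    · congr 1 with x
      rw [add_pow, Finset.sum_mul]
      exact Finset.sum_congr rfl fun _ _ => by rw [mul_pow]; ring
    · intro k _
      have hg : Integrable fun t : ℝ => (t : ℂ) ^ (s - k) * Real.exp (-t ^ 2) := by
        simpa using (Real.integrable_pow_mul_exp_neg_sq (s - k)).ofReal (𝕜 := ℂ)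
      have hp := (integrable_linear_pow_mul_axialWeight α β k).mul_prod hg
      exact hp.const_mul (s.choose k * c ^ (s - k) : ℂ)
  rw [hsum]
  rcases Nat.even_or_odd' s with ⟨r, rfl | rfl⟩
  · rw [← sum_gaussianMoments]
    have hinj : Set.InjOn (fun j : ℕ => 2 * j) (Finset.range (r + 1)) :=
      fun a _ b _ h => by simpa using h
    rw [← Finset.sum_subset (s₁ := (Finset.range (r + 1)).image (2 * ·)), Finset.sum_image hinj,
      Complex.ofReal_sum, Finset.sum_mul]
    · refine Finset.sum_congr rfl fun j hj => ?_
      have hj := Finset.mem_range_succ_iff.mp hj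
      rw [integral_linear_pow_even_mul_axialWeight, h, ← Nat.mul_sub,
        Real.integral_even_pow_mul_exp_neg_sq]
      obtain ⟨m, rfl⟩ := Nat.exists_eq_add_of_le hj
      rw [Nat.add_sub_cancel_left, show -c ^ 2 / 4 = (-1 / 4) * c ^ 2 by ring]
      push_cast
      rw [mul_pow]
      ring
    · intro k hk
      simp only [Finset.mem_image, Finset.mem_range] at hk ⊢
      omega
    · intro k _ hk
      rcases Nat.even_or_odd' k with ⟨j, rfl | rfl⟩
      · refine absurd (Finset.mem_image_of_mem _ ?_) hk
        simp_all
      · rw [integral_linear_pow_odd_mul_axialWeight _ _ ⟨j, rfl⟩]; simp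
  · rw [onsagerEigenvalue, if_neg (by simp)]
    simp only [mul_zero, Complex.ofReal_zero, zero_mul]
    refine Finset.sum_eq_zero fun k hk => ?_
    have hk := Finset.mem_range_succ_iff.mp hk
    rcases Nat.even_or_odd k with hke | hko
    · rw [Real.integral_odd_pow_mul_exp_neg_sq (Nat.Odd.sub_even hk ⟨r, rfl⟩ hke)]; simp
    · rw [integral_linear_pow_odd_mul_axialWeight _ _ hko]; simp

theorem integral_mul_exp_neg_norm_sq_of_homogeneous {Φ : EuclideanSpace ℝ (Fin 3) → ℂ} {s : ℕ}
    (hΦ : ∀ r : ℝ, 0 < r → ∀ x, Φ (r • x) = r ^ (s + 1) * Φ x) :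
    ∫ x, Φ x * Real.exp (-‖x‖ ^ 2) =
      (1 / 2 * Real.Gamma (s / 2 + 2) : ℝ) * ∫ q : S2, Φ q ∂sphereMeasure := by
  let E := EuclideanSpace ℝ (Fin 3)
  let μ : Measure E := volume
  have hdim : Module.finrank ℝ E - 1 = 2 := by simp [E]
  have hradial : ∫ r : Set.Ioi (0 : ℝ), ((r : ℝ) ^ (s + 1) * Real.exp (-(r : ℝ) ^ 2) : ℂ)
      ∂.volumeIoiPow 2 = (1 / 2 * Real.Gamma (s / 2 + 2) : ℝ) := by
    simp only [Measure.volumeIoiPow, ENNReal.ofReal]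
    rw [integral_withDensity_eq_integral_smul (measurable_subtype_coe.pow_const _).real_toNNReal,
      integral_subtype_comap measurableSet_Ioi fun a : ℝ => Real.toNNReal (a ^ 2) •
        ((a : ℂ) ^ (s + 1) * Real.exp (-a ^ 2) : ℂ),
      show (s : ℝ) / 2 + 2 = ((s + 3 : ℕ) + 1) / 2 by push_cast; ring,
      ← Real.integral_Ioi_pow_mul_exp_neg_sq, ← integral_complex_ofReal]
    refine setIntegral_congr_fun measurableSet_Ioi fun x hx => ?_
    simp only [NNReal.smul_def, Real.coe_toNNReal _ (sq_nonneg x), Complex.real_smul]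
    push_cast
    ring
  calc
    ∫ x, Φ x * Real.exp (-‖x‖ ^ 2) =
        ∫ x : ({0}ᶜ : Set E), Φ x * Real.exp (-‖(x : E)‖ ^ 2) ∂(μ.comap (↑)) := by
      rw [integral_subtype_comap (measurableSet_singleton _).compl
        fun x : E => Φ x * Real.exp (-‖x‖ ^ 2), restrict_compl_singleton]
    _ = ∫ x : S2 × Set.Ioi (0 : ℝ), Φ (x.1 : E) *
          (((x.2 : ℝ) : ℂ) ^ (s + 1) * Real.exp (-(x.2 : ℝ) ^ 2))
          ∂μ.toSphere.prod (.volumeIoiPow 2) := by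
      rw [← hdim, ← μ.measurePreserving_homeomorphUnitSphereProd.integral_comp
        (Homeomorph.measurableEmbedding _)]
      congr 1 with x
      have hx : 0 < ‖(x : E)‖ := norm_pos_iff.mpr x.2
      have := hΦ ‖(x : E)‖ hx (‖(x : E)‖⁻¹ • x)
      rw [smul_inv_smul₀ hx.ne'] at this
      simp only [homeomorphUnitSphereProd_apply_fst_coe, homeomorphUnitSphereProd_apply_snd_coe]
      rw [this]; ring
    _ = (∫ q : S2, Φ q ∂sphereMeasure) * (1 / 2 * Real.Gamma (s / 2 + 2) : ℝ) := by
      rw [← hradial]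
      exact integral_prod_mul (fun q : S2 => Φ q)
        (fun r : Set.Ioi (0 : ℝ) => ((r : ℝ) ^ (s + 1) * Real.exp (-(r : ℝ) ^ 2) : ℂ))
    _ = _ := mul_comm _ _

/-- Cylindrical coordinates `(z, t) ↦ Re z • b 0 + Im z • b 1 + t • b 2`. -/
def cylindrical (b : OrthonormalBasis (Fin 3) ℝ (EuclideanSpace ℝ (Fin 3))) :
    ℂ × ℝ ≃ᵐ EuclideanSpace ℝ (Fin 3) :=
  ((MeasurableEquiv.prodComm.trans
    ((MeasurableEquiv.refl ℝ).prodCongr Complex.measurableEquivPi)).trans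
    (MeasurableEquiv.piFinSuccAbove (fun _ : Fin 3 => ℝ) 2).symm).trans
    ((MeasurableEquiv.toLp 2 (Fin 3 → ℝ)).trans b.measurableEquiv.symm)

theorem measurePreserving_cylindrical
    (b : OrthonormalBasis (Fin 3) ℝ (EuclideanSpace ℝ (Fin 3))) :
    MeasurePreserving (cylindrical b) :=
  ((Measure.measurePreserving_swap.trans
    ((MeasurePreserving.id volume).prod Complex.volume_preserving_equiv_pi)).trans
    (volume_preserving_piFinSuccAbove (fun _ : Fin 3 => ℝ) 2).symm).trans
    ((PiLp.volume_preserving_toLp (Fin 3)).trans b.measurePreserving_repr_symm)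

theorem cylindrical_apply (b : OrthonormalBasis (Fin 3) ℝ (EuclideanSpace ℝ (Fin 3)))
    (x : ℂ × ℝ) : cylindrical b x = b.repr.symm !₂[x.1.re, x.1.im, x.2] := by
  change b.repr.symm _ = _
  congr 1
  ext i
  fin_cases i <;> rfl

theorem exists_orthonormalBasis_apply_two_eq (p : S2) :
    ∃ b : OrthonormalBasis (Fin 3) ℝ (EuclideanSpace ℝ (Fin 3)),
      b 2 = (p : EuclideanSpace ℝ (Fin 3)) := by
  obtain ⟨b, hb⟩ := Orthonormal.exists_orthonormalBasis_extension_of_card_eq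
    (𝕜 := ℝ) (ι := Fin 3) (by simp) (v := fun _ => (p : EuclideanSpace ℝ (Fin 3))) (s := {2})
    ⟨fun i => by simp, fun i j hij => absurd (Subsingleton.elim i j) hij⟩
  exact ⟨b, hb 2 rfl⟩

theorem OrthonormalBasis.sum_apply_mul_apply {ι : Type*} [Fintype ι] [DecidableEq ι]
    (b : OrthonormalBasis ι ℝ (EuclideanSpace ℝ ι)) (k l : ι) :
    ∑ i, b i k * b i l = if k = l then 1 else 0 := by
  have := b.sum_inner_mul_inner (EuclideanSpace.single k 1) (EuclideanSpace.single l 1)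
  simpa [EuclideanSpace.inner_single_left, EuclideanSpace.inner_single_right, eq_comm,
    Pi.single_apply] using this

/-- The bilinear dot product of a complex and a real vector. -/
def complexDot (a : Fin 3 → ℂ) (x : EuclideanSpace ℝ (Fin 3)) : ℂ := ∑ k, a k * x k

theorem continuous_complexDot (a : Fin 3 → ℂ) : Continuous (complexDot a) := by
  unfold complexDot; fun_prop

theorem complexDot_smul (a : Fin 3 → ℂ) (r : ℝ) (x : EuclideanSpace ℝ (Fin 3)) :
    complexDot a (r • x) = r * complexDot a x := by
  simp only [complexDot, PiLp.smul_apply, smul_eq_mul, Complex.ofReal_mul, Finset.mul_sum]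
  exact Finset.sum_congr rfl fun _ _ => by ring

theorem sum_complexDot_sq (b : OrthonormalBasis (Fin 3) ℝ (EuclideanSpace ℝ (Fin 3)))
    (a : Fin 3 → ℂ) : ∑ i, complexDot a (b i) ^ 2 = ∑ k, a k ^ 2 := by
  have h : ∀ k l, ∑ i, (b i k : ℂ) * b i l = if k = l then 1 else 0 := fun k l => by
    have := congrArg (fun r : ℝ => (r : ℂ)) (b.sum_apply_mul_apply k l)
    push_cast at this
    rw [this]; split_ifs <;> simp
  calc
    _ = ∑ i, ∑ k, ∑ l, a k * a l * ((b i k : ℂ) * b i l) := by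
      refine Finset.sum_congr rfl fun i _ => ?_
      rw [complexDot, sq, Finset.sum_mul_sum]
      exact Finset.sum_congr rfl fun _ _ => Finset.sum_congr rfl fun _ _ => by ring
    _ = ∑ k, ∑ l, a k * a l * ∑ i, (b i k : ℂ) * b i l := by
      rw [Finset.sum_comm]
      refine Finset.sum_congr rfl fun k _ => ?_
      rw [Finset.sum_comm]
      exact Finset.sum_congr rfl fun l _ => (Finset.mul_sum _ _ _).symm
    _ = _ := by simp [h, sq]

theorem complexDot_cylindrical (b : OrthonormalBasis (Fin 3) ℝ (EuclideanSpace ℝ (Fin 3)))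
    (a : Fin 3 → ℂ) (x : ℂ × ℝ) :
    complexDot a (cylindrical b x) =
      (complexDot a (b 0) - complexDot a (b 1) * Complex.I) / 2 * x.1 +
      (complexDot a (b 0) + complexDot a (b 1) * Complex.I) / 2 * starRingEnd ℂ x.1 +
      complexDot a (b 2) * x.2 := by
  have hz : starRingEnd ℂ x.1 = x.1.re - x.1.im * Complex.I := by
    apply Complex.ext <;> simp
  have hlin : complexDot a (cylindrical b x) = complexDot a (b 0) * x.1.re +
      complexDot a (b 1) * x.1.im + complexDot a (b 2) * x.2 := by
    rw [cylindrical_apply, ← b.sum_repr_symm]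
    simp [complexDot, Fin.sum_univ_three]
    ring
  rw [hlin, hz]
  linear_combination (complexDot a (b 0) - complexDot a (b 1) * Complex.I) / 2 *
    Complex.re_add_im x.1 + complexDot a (b 1) * x.1.im * Complex.I_sq

theorem integral_onsager_mul_complexDot_pow {a : Fin 3 → ℂ} (ha : ∑ k, a k ^ 2 = 0) (s : ℕ)
    (p : S2) :
    ∫ q : S2, (Real.sqrt (1 - (inner (𝕜 := ℝ) (p : EuclideanSpace ℝ (Fin 3))
        (q : EuclideanSpace ℝ (Fin 3))) ^ 2) : ℂ) * complexDot a q ^ s ∂sphereMeasure =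
      onsagerEigenvalue s * complexDot a p ^ s := by
  obtain ⟨b, hb⟩ := exists_orthonormalBasis_apply_two_eq p
  set Φ : EuclideanSpace ℝ (Fin 3) → ℂ := fun x =>
    (Real.sqrt (‖x‖ ^ 2 - (inner (𝕜 := ℝ) (p : EuclideanSpace ℝ (Fin 3)) x) ^ 2) : ℂ) *
      complexDot a x ^ s with hΦ
  have hhom : ∀ r : ℝ, 0 < r → ∀ x, Φ (r • x) = r ^ (s + 1) * Φ x := by
    intro r hr x
    simp only [hΦ]
    rw [complexDot_smul, norm_smul, inner_smul_right, mul_pow, mul_pow,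
      Real.norm_eq_abs, sq_abs, ← mul_sub, Real.sqrt_mul (sq_nonneg r), Real.sqrt_sq hr.le, mul_pow]
    push_cast
    ring
  have hcyl : ∀ x : ℂ × ℝ, Φ (cylindrical b x) * Real.exp (-‖cylindrical b x‖ ^ 2) =
      ((complexDot a (b 0) - complexDot a (b 1) * Complex.I) / 2 * x.1 +
      (complexDot a (b 0) + complexDot a (b 1) * Complex.I) / 2 * starRingEnd ℂ x.1 +
      complexDot a (b 2) * x.2) ^ s * (axialWeight x.1 * Real.exp (-x.2 ^ 2)) := by
    intro x
    have hn : ‖cylindrical b x‖ ^ 2 = ‖x.1‖ ^ 2 + x.2 ^ 2 := by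
      rw [cylindrical_apply, LinearIsometryEquiv.norm_map, EuclideanSpace.real_norm_sq_eq,
        Fin.sum_univ_three, ← Complex.normSq_eq_norm_sq, Complex.normSq_apply]
      simp; ring
    have hi : inner ℝ (p : EuclideanSpace ℝ (Fin 3)) (cylindrical b x) = x.2 := by
      rw [← hb, cylindrical_apply, ← b.repr_apply_apply]
      simp
    simp only [hΦ]
    rw [hi, hn, add_sub_cancel_right, Real.sqrt_sq (norm_nonneg _), complexDot_cylindrical,
      axialWeight, neg_add, Real.exp_add]
    push_cast
    ring
  have hiso : (complexDot a (b 0) - complexDot a (b 1) * Complex.I) / 2 *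
      ((complexDot a (b 0) + complexDot a (b 1) * Complex.I) / 2) =
      -complexDot a (b 2) ^ 2 / 4 := by
    have := sum_complexDot_sq b a
    rw [ha, Fin.sum_univ_three] at this
    linear_combination this / 4 - (complexDot a (b 1)) ^ 2 / 4 * Complex.I_sq
  have hpolar := integral_mul_exp_neg_norm_sq_of_homogeneous hhom
  rw [← (measurePreserving_cylindrical b).integral_comp', integral_congr_ae (.of_forall hcyl),
    integral_isotropic_pow_mul_axialWeight hiso, Complex.ofReal_mul, mul_assoc] at hpolar
  have hG : ((1 / 2 * Real.Gamma (s / 2 + 2) : ℝ) : ℂ) ≠ 0 := by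
    have : 0 < Real.Gamma ((s : ℝ) / 2 + 2) := Real.Gamma_pos_of_pos (by positivity)
    exact_mod_cast (by positivity : (1 / 2 * Real.Gamma ((s : ℝ) / 2 + 2)) ≠ 0)
  rw [← hb, mul_left_cancel₀ hG hpolar]
  refine integral_congr_ae (.of_forall fun q => ?_)
  simp [hΦ, hb, norm_eq_of_mem_sphere q]

theorem Polynomial.iteratedDeriv_eval (P : Polynomial ℝ) (k : ℕ) (x : ℝ) :
    iteratedDeriv k (fun y => P.eval y) x = k.factorial * (taylor x P).coeff k := by
  have h : ∀ k : ℕ, iteratedDeriv k (fun y => P.eval y) =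
      fun y => (Polynomial.derivative^[k] P).eval y := by
    intro k
    induction k with
    | zero => simp
    | succ k ih =>
      rw [iteratedDeriv_succ, ih]
      ext y
      rw [Polynomial.deriv, Function.iterate_succ_apply']
  rw [h, taylor_coeff, ← factorial_smul_hasseDeriv]
  simp

theorem Polynomial.exists_coeff_eq_sum_eval (N k : ℕ) : ∃ w : ℕ → ℂ, ∀ P : Polynomial ℂ,
    P.degree < N → P.coeff k = ∑ i ∈ Finset.range N, w i * P.eval (i : ℂ) := by
  refine ⟨fun i => (Lagrange.basis (Finset.range N) (fun i : ℕ => (i : ℂ)) i).coeff k,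
    fun P hP => ?_⟩
  have := Lagrange.eq_interpolate (s := Finset.range N) (v := fun i : ℕ => (i : ℂ)) (f := P)
    Nat.cast_injective.injOn (by simpa using hP)
  nth_rewrite 1 [this]
  rw [Lagrange.interpolate_apply, finsetSum_coeff]
  exact Finset.sum_congr rfl fun i _ => by rw [coeff_C_mul, mul_comm]

open Polynomial in
theorem coeff_quadratic_pow_eq {ζ ζ' : ℂ} (h : ζ = 0 → ζ' = 0) (t : ℂ) (s j : ℕ) :
    ((C (-ζ') + C (2 * t) * X + C ζ * X ^ 2) ^ s).coeff j =
      ζ ^ ((j : ℤ) - s) * ((C (-(ζ * ζ')) + C (2 * t) * X + X ^ 2) ^ s).coeff j := by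
  rcases eq_or_ne ζ 0 with rfl | hζ
  · rw [h rfl]
    have e : (C (-(0 * 0)) + C (2 * t) * X + X ^ 2 : ℂ[X]) ^ s = X ^ s * (X + C (2 * t)) ^ s := by
      rw [← mul_pow]; simp; ring
    rcases eq_or_ne j s with rfl | hj
    · rw [e, coeff_X_pow_mul', if_pos le_rfl]
      simp [coeff_zero_eq_eval_zero, mul_pow, ← C_pow, -map_mul, -map_pow]
    · rw [zero_zpow _ (by omega), zero_mul]
      simp [mul_pow, ← C_pow, coeff_X_pow, hj, -map_mul, -map_pow]
  · have e : C (ζ ^ s) * (C (-ζ') + C (2 * t) * X + C ζ * X ^ 2) ^ s =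
        ((C (-(ζ * ζ')) + C (2 * t) * X + X ^ 2) ^ s).comp (C ζ * X) := by
      rw [C_pow, ← mul_pow]
      simp only [pow_comp, add_comp, mul_comp, C_comp, X_comp]
      congr 1
      simp only [map_neg, map_mul]
      ring
    have e := congrArg (fun P => P.coeff j) e
    simp only [coeff_C_mul, comp_C_mul_X_coeff] at e
    rw [zpow_sub₀ hζ, zpow_natCast, zpow_natCast]
    rw [div_mul_eq_mul_div, eq_div_iff (pow_ne_zero s hζ)]
    linear_combination e

open Polynomial in
/-- Rodrigues' formula in terms of the coefficients of a power of a quadratic polynomial. -/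
theorem iteratedDeriv_sq_sub_one_pow (s j : ℕ) (x : ℝ) :
    ((iteratedDeriv j (fun y : ℝ => (y ^ 2 - 1) ^ s) x : ℝ) : ℂ) =
      j.factorial * ((C ((x : ℂ) ^ 2 - 1) + C (2 * (x : ℂ)) * X + X ^ 2) ^ s).coeff j := by
  have h := iteratedDeriv_eval ((X ^ 2 - 1) ^ s) j x
  have e : taylor x ((X ^ 2 - 1 : ℝ[X]) ^ s) = (C (x ^ 2 - 1) + C (2 * x) * X + X ^ 2) ^ s := by
    rw [taylor_apply]
    simp only [pow_comp, sub_comp, X_comp, one_comp]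
    congr 1
    simp only [map_sub, map_pow, map_mul, map_one]
    rw [show (C 2 : ℝ[X]) = 2 from rfl]
    ring
  simp only [eval_pow, eval_sub, eval_X, eval_one] at h
  rw [h, e, Complex.ofReal_mul, Complex.ofReal_natCast, ← Complex.ofRealHom_eq_coe,
    ← coeff_map]
  simp

/-- The point `x + iy` of the complex plane below a point `(x, y, z)` of the sphere. -/
def planar (q : S2) : ℂ :=
  ⟨(q : EuclideanSpace ℝ (Fin 3)) 0, (q : EuclideanSpace ℝ (Fin 3)) 1⟩

theorem norm_planar_sq (q : S2) :
    ‖planar q‖ ^ 2 = 1 - (q : EuclideanSpace ℝ (Fin 3)) 2 ^ 2 := by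
  have h := EuclideanSpace.real_norm_sq_eq (q : EuclideanSpace ℝ (Fin 3))
  rw [norm_eq_of_mem_sphere, Fin.sum_univ_three] at h
  rw [← Complex.normSq_eq_norm_sq, Complex.normSq_apply, planar]
  linarith

theorem exp_azimuth_mul_rpow (n : ℤ) (q : S2) :
    Complex.exp (Complex.I * n * azimuth q) *
      ((1 - (q : EuclideanSpace ℝ (Fin 3)) 2 ^ 2) ^ ((n : ℝ) / 2) : ℝ) = planar q ^ n := by
  have h1 : (‖planar q‖ ^ 2) ^ ((n : ℝ) / 2) = ‖planar q‖ ^ n := by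
    rw [← Real.rpow_natCast, ← Real.rpow_mul (norm_nonneg _), ← Real.rpow_intCast]
    congr 1; push_cast; ring
  have h2 : Complex.exp (Complex.I * n * azimuth q) =
      Complex.exp (Complex.arg (planar q) * Complex.I) ^ n := by
    rw [← Complex.exp_int_mul]; congr 1; rw [azimuth, planar]; ring
  rw [← norm_planar_sq, h1, h2]
  nth_rewrite 3 [← Complex.norm_mul_exp_arg_mul_I (planar q)]
  rw [mul_zpow, Complex.ofReal_zpow, mul_comm]

open Polynomial in
/-- Generating polynomial of the spherical harmonics of degree `s`. -/
def harmonicGen (s : ℕ) (q : S2) : ℂ[X] :=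
  (C (-starRingEnd ℂ (planar q)) + C (2 * ((q : EuclideanSpace ℝ (Fin 3)) 2 : ℂ)) * X +
    C (planar q) * X ^ 2) ^ s

theorem degree_harmonicGen_lt (s : ℕ) (q : S2) : (harmonicGen s q).degree < (2 * s + 1 : ℕ) := by
  have : (harmonicGen s q).natDegree ≤ s * 2 := by unfold harmonicGen; compute_degree
  exact Polynomial.degree_le_natDegree.trans_lt (by exact_mod_cast (by omega))

/-- Coefficients of an isotropic linear form, cf. `eval_harmonicGen`. -/
def isotropicVector (u : ℂ) : Fin 3 → ℂ := ![u ^ 2 - 1, Complex.I * (u ^ 2 + 1), 2 * u]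

theorem sum_isotropicVector_sq (u : ℂ) : ∑ k, isotropicVector u k ^ 2 = 0 := by
  simp [isotropicVector, Fin.sum_univ_three]
  linear_combination (u ^ 2 + 1) ^ 2 * Complex.I_sq

theorem eval_harmonicGen (s : ℕ) (q : S2) (u : ℂ) :
    (harmonicGen s q).eval u = complexDot (isotropicVector u) q ^ s := by
  have hz : planar q = (q : EuclideanSpace ℝ (Fin 3)) 0 +
      (q : EuclideanSpace ℝ (Fin 3)) 1 * Complex.I := Complex.mk_eq_add_mul_I _ _
  simp only [harmonicGen, Polynomial.eval_pow, Polynomial.eval_add, Polynomial.eval_mul,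
    Polynomial.eval_C, Polynomial.eval_X, complexDot, isotropicVector, Fin.sum_univ_three, hz]
  congr 1
  simp
  ring

theorem sphHarm_eq_mul_coeff {s : ℕ} {n : ℤ} (hn : |n| ≤ (s : ℤ)) (q : S2) :
    sphHarm s n q = (sphNormal s n * (1 / (2 ^ s * s.factorial)) *
      ((s : ℤ) + n).toNat.factorial : ℂ) * (harmonicGen s q).coeff ((s : ℤ) + n).toNat := by
  have hj : (((s : ℤ) + n).toNat : ℤ) - s = n := by
    have := neg_abs_le n
    omega
  have h0 : planar q = 0 → starRingEnd ℂ (planar q) = 0 := fun h => by simp [h]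
  have hzz : -(planar q * starRingEnd ℂ (planar q)) =
      ((q : EuclideanSpace ℝ (Fin 3)) 2 : ℂ) ^ 2 - 1 := by
    rw [Complex.mul_conj, Complex.normSq_eq_norm_sq, norm_planar_sq]; push_cast; ring
  rw [harmonicGen, coeff_quadratic_pow_eq h0, hj, hzz, ← exp_azimuth_mul_rpow, sphHarm,
    assocLegendre, Complex.ofReal_mul, Complex.ofReal_mul, iteratedDeriv_sq_sub_one_pow]
  push_cast
  ring

/-- Every spherical harmonic `Y_s^n` is an eigenfunction of the integral operator with the
Onsager kernel `√(1 − (p·q)²)`, with eigenvalue `μ_O(s)`: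
`∫_{S²} √(1 − (p·q)²) Y_s^n(q) dq = μ_O(s) Y_s^n(p)`. -/
theorem sphHarm_eigenfunction_onsager (s : ℕ) (n : ℤ) (hn : |n| ≤ (s : ℤ)) (p : S2) :
    (∫ q : S2, (Real.sqrt (1 - (inner (𝕜 := ℝ) (p : EuclideanSpace ℝ (Fin 3))
        (q : EuclideanSpace ℝ (Fin 3))) ^ 2) : ℂ) * sphHarm s n q ∂sphereMeasure) =
      (onsagerEigenvalue s : ℝ) * sphHarm s n p := by
  obtain ⟨w, hw⟩ := Polynomial.exists_coeff_eq_sum_eval (2 * s + 1) ((s : ℤ) + n).toNat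
  set K : ℂ := sphNormal s n * (1 / (2 ^ s * s.factorial)) * ((s : ℤ) + n).toNat.factorial
  have hY : ∀ q, sphHarm s n q = ∑ i ∈ Finset.range (2 * s + 1),
      K * w i * complexDot (isotropicVector i) q ^ s := fun q => by
    rw [sphHarm_eq_mul_coeff hn, hw _ (degree_harmonicGen_lt s q), Finset.mul_sum]
    exact Finset.sum_congr rfl fun i _ => by rw [eval_harmonicGen]; exact (mul_assoc _ _ _).symm
  have hint : ∀ a : Fin 3 → ℂ, Integrable (fun q : S2 =>
      (Real.sqrt (1 - (inner (𝕜 := ℝ) (p : EuclideanSpace ℝ (Fin 3))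
        (q : EuclideanSpace ℝ (Fin 3))) ^ 2) : ℂ) * complexDot a q ^ s) sphereMeasure := by
    intro a
    have : IsFiniteMeasure sphereMeasure := by unfold sphereMeasure; infer_instance
    have hc := (continuous_complexDot a).comp (continuous_subtype_val (p := (· ∈ S2)))
    exact (by fun_prop : Continuous _).integrable_of_hasCompactSupport
      (HasCompactSupport.of_compactSpace _)
  simp only [hY, Finset.mul_sum, mul_left_comm _ (K * w _)]
  rw [integral_finsetSum _ fun i _ => (hint _).const_mul _]
  refine Finset.sum_congr rfl fun i _ => ?_
  rw [integral_const_mul, integral_onsager_mul_complexDot_pow (sum_isotropicVector_sq i)]
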